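/- The cohomology of the complex (𝒜, K) is concentrated in charge c_G: if λ ∈ ℤ with λ ≠ c_G and f ∈ 𝒜_λ satisfies K(f) = 0, then f lies in the image of K; explicitly, f = K((λ − c_G)^{−1}·R·f). -/

import Mathlib

open MvPolynomial

namespace PeriodCI

/-- The coordinate ring `A = ℂ[q_1,…,q_N]`, `N = n+k+1`, with `q_1,…,q_k` the `y`-variables
and `q_{k+1},…,q_N` the `x`-variables. -/
abbrev CoordRing (n k : ℕ) := MvPolynomial (Fin (n + k + 1)) ℂ

/-- The super-algebra `𝒜 = A[η_1,…,η_N]`, modelled as functions from subsets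
`T ⊆ {1,…,N}` (the monomial `η_T`) to `A`. -/
abbrev SuperAlg (n k : ℕ) := Finset (Fin (n + k + 1)) → CoordRing n k

/-- the variable `y_i` among the `q`'s. -/
def yVar (n k : ℕ) (i : Fin k) : Fin (n + k + 1) := ⟨i.1, by have := i.isLt; omega⟩

/-- the variable `x_j` among the `q`'s. -/
def xVar (n k : ℕ) (j : Fin (n + 1)) : Fin (n + k + 1) := ⟨k + j.1, by have := j.isLt; omega⟩

/-- The Dwork potential `S = Σ_{i=1}^k y_i · G_i(x)`. -/
noncomputable def dwork (n k : ℕ) (G : Fin k → MvPolynomial (Fin (n + 1)) ℂ) : CoordRing n k :=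
  ∑ i : Fin k, X (yVar n k i) * rename (xVar n k) (G i)

/-- The odd derivation `∂/∂η_i` of `𝒜` (A-linear, with `∂η_j/∂η_i = δ_{ij}`). -/
noncomputable def etaDeriv (n k : ℕ) (i : Fin (n + k + 1)) (f : SuperAlg n k) : SuperAlg n k :=
  fun s =>
    if i ∈ s then 0
    else (-1 : CoordRing n k) ^ (s.filter fun j => j < i).card * f (insert i s)

/-- `Q = Σ_i (∂P/∂q_i)·(∂/∂η_i)` for a potential `P`. -/
noncomputable def Qop (n k : ℕ) (P : CoordRing n k) (f : SuperAlg n k) : SuperAlg n k :=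
  fun s => ∑ i : Fin (n + k + 1), pderiv i P * etaDeriv n k i f s

/-- `Δ = Σ_i (∂/∂q_i)(∂/∂η_i)`. -/
noncomputable def Dop (n k : ℕ) (f : SuperAlg n k) : SuperAlg n k :=
  fun s => ∑ i : Fin (n + k + 1), pderiv i (etaDeriv n k i f s)

/-- `K = Q + Δ`. -/
noncomputable def Kop (n k : ℕ) (P : CoordRing n k) (f : SuperAlg n k) : SuperAlg n k :=
  fun s => Qop n k P f s + Dop n k f s

/-- The Koszul sign `(−1)^{#{(i,j) ∈ t×u : i > j}}`. -/
def ksign (n k : ℕ) (t u : Finset (Fin (n + k + 1))) : ℤ :=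
  (-1) ^ ((t ×ˢ u).filter fun p => p.2 < p.1).card

/-- The super-commutative product of `𝒜` (Koszul signs from `η_iη_j = −η_jη_i`). -/
noncomputable def gmul (n k : ℕ) (f g : SuperAlg n k) : SuperAlg n k :=
  fun s => ∑ t ∈ s.powerset, ksign n k t (s \ t) • (f t * g (s \ t))

/-- `f` is homogeneous of `η`-degree `d` (i.e. of cohomological degree `−d`):
it is supported on subsets of cardinality `d`. -/
def IsEDeg (n k : ℕ) (d : ℕ) (f : SuperAlg n k) : Prop :=
  ∀ s : Finset (Fin (n + k + 1)), s.card ≠ d → f s = 0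

/-- The descendant bracket `ℓ₂ᴷ(a,b) = K(a·b) − K(a)·b − (−1)^{|a|}·a·K(b)` for `a`
homogeneous of `η`-degree `da` (so of cohomological degree `|a| = −da`;
only the parity of `da` enters the sign). -/
noncomputable def ell2 (n k : ℕ) (P : CoordRing n k) (da : ℕ) (a b : SuperAlg n k) :
    SuperAlg n k :=
  Kop n k P (gmul n k a b) - gmul n k (Kop n k P a) b
    - ((-1 : ℤ) ^ da) • gmul n k a (Kop n k P b)

/-- The embedding `A ⊆ 𝒜` in degree 0. -/
noncomputable def embA (n k : ℕ) (p : CoordRing n k) : SuperAlg n k := fun s => if s = ∅ then p else 0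

/-- The charge of the variable `q_μ`: `ch(y_i) = −d_i`, `ch(x_j) = 1`. -/
def chq (n k : ℕ) (d : Fin k → ℕ) (μ : Fin (n + k + 1)) : ℤ :=
  if h : (μ : ℕ) < k then -(d ⟨μ, h⟩ : ℤ) else 1

/-- The charge of the monomial `q^m · η_s` (with `ch(η_μ) = −ch(q_μ)`). -/
def chOf (n k : ℕ) (d : Fin k → ℕ) (m : Fin (n + k + 1) →₀ ℕ)
    (s : Finset (Fin (n + k + 1))) : ℤ :=
  (∑ μ : Fin (n + k + 1), (m μ : ℤ) * chq n k d μ) - ∑ μ ∈ s, chq n k d μ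

/-- `f ∈ 𝒜_λ`: every monomial of `f` has charge `λ`. -/
def HasCharge (n k : ℕ) (d : Fin k → ℕ) (lam : ℤ) (f : SuperAlg n k) : Prop :=
  ∀ s : Finset (Fin (n + k + 1)), ∀ m ∈ (f s).support, chOf n k d m s = lam

/-- The weight of the variable `q_μ`: `wt(y_i) = 1`, `wt(x_j) = 0`. -/
def wtq (n k : ℕ) (μ : Fin (n + k + 1)) : ℕ := if (μ : ℕ) < k then 1 else 0

/-- The weight of the monomial `q^m · η_s` (with `wt(η_μ) = 1 − wt(q_μ)`). -/
def wtOf (n k : ℕ) (m : Fin (n + k + 1) →₀ ℕ) (s : Finset (Fin (n + k + 1))) : ℕ :=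
  (∑ μ : Fin (n + k + 1), m μ * wtq n k μ) + (s.filter fun μ : Fin (n + k + 1) => ¬ ((μ : ℕ) < k)).card

/-- `f ∈ 𝒜_{(w)}`: every monomial of `f` has weight `w` (stated with `w : ℤ` so that
`𝒜_{(−1)} = 0` is automatic). -/
def HasWeight (n k : ℕ) (w : ℤ) (f : SuperAlg n k) : Prop :=
  ∀ s : Finset (Fin (n + k + 1)), ∀ m ∈ (f s).support, (wtOf n k m s : ℤ) = w

/-- `f ∈ F^j_wt 𝒜 = ⊕_{0 ≤ w ≤ j} 𝒜_{(w)}`. -/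
def InWtFilt (n k : ℕ) (j : ℕ) (f : SuperAlg n k) : Prop :=
  ∀ s : Finset (Fin (n + k + 1)), ∀ m ∈ (f s).support, wtOf n k m s ≤ j

/-- `R = Σ_μ ch(q_μ)·q_μ·η_μ`. -/
noncomputable def Rel (n k : ℕ) (d : Fin k → ℕ) : SuperAlg n k :=
  fun s => ∑ μ : Fin (n + k + 1), if s = {μ} then chq n k d μ • X μ else 0

/-- The background charge `c_G = Σ_i d_i − (n+1)`. -/
def cG (n k : ℕ) (d : Fin k → ℕ) : ℤ := (∑ i : Fin k, (d i : ℤ)) - (n + 1)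


/-- Euler's identity for a polynomial that is homogeneous for integer weights. -/
theorem sum_intWeight_mul_X_mul_pderiv {σ R : Type*} [Fintype σ] [CommRing R] {w : σ → ℤ} {e : ℤ}
    {p : MvPolynomial σ R} (hp : p.IsWeightedHomogeneous w e) :
    ∑ i, (w i : MvPolynomial σ R) * (X i * pderiv i p) = (e : MvPolynomial σ R) * p := by
  have key : ∀ m ∈ p.support, ∑ i, (w i : MvPolynomial σ R) *
      (X i * pderiv i (monomial m (coeff m p))) =
        (e : MvPolynomial σ R) * monomial m (coeff m p) := by
    intro m hm
    have h := hp (mem_support_iff.mp hm)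
    rw [Finsupp.weight_eq_sum] at h
    simp_rw [X_mul_pderiv_monomial, ← h, nsmul_eq_mul, ← mul_assoc, ← Finset.sum_mul]
    congr 1
    push_cast
    exact Finset.sum_congr rfl fun i _ => by simp [mul_comm]
  have h := Finset.sum_congr rfl key
  rw [← Finset.mul_sum, Finset.sum_comm, support_sum_monomial_coeff] at h
  rw [← h]
  refine Finset.sum_congr rfl fun i _ => ?_
  rw [← Finset.mul_sum, ← Finset.mul_sum, ← map_sum, support_sum_monomial_coeff]

theorem isWeightedHomogeneous_rename {σ τ R M : Type*} [CommSemiring R] [AddCommMonoid M]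
    {e : σ → τ} {w : τ → M} {m : M} {p : MvPolynomial σ R}
    (hp : p.IsWeightedHomogeneous (w ∘ e) m) : (rename e p).IsWeightedHomogeneous w m := by
  intro u hu
  obtain ⟨v, rfl, hv⟩ := coeff_rename_ne_zero e p u hu
  rw [← hp hv, Finsupp.weight_apply, Finsupp.weight_apply,
    Finsupp.sum_mapDomain_index (fun _ => by simp) (fun _ _ _ => by simp [add_smul])]
  rfl

theorem chq_yVar (n k : ℕ) (d : Fin k → ℕ) (i : Fin k) : chq n k d (yVar n k i) = -(d i : ℤ) := by
  simp [chq, yVar]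

theorem chq_xVar (n k : ℕ) (d : Fin k → ℕ) (j : Fin (n + 1)) : chq n k d (xVar n k j) = 1 := by
  simp [chq, xVar]

theorem sum_chq (n k : ℕ) (d : Fin k → ℕ) : ∑ μ, chq n k d μ = -cG n k d := by
  have e : k + (n + 1) = n + k + 1 := by omega
  rw [← (finCongr e).sum_comp, Fin.sum_univ_add]
  have h₁ : ∀ i : Fin k, finCongr e (Fin.castAdd (n + 1) i) = yVar n k i := fun i => rfl
  have h₂ : ∀ j : Fin (n + 1), finCongr e (Fin.natAdd k j) = xVar n k j := fun j => rfl
  simp only [h₁, h₂, chq_yVar, chq_xVar, cG]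
  simp
  ring

/-- The Dwork potential has charge `0`. -/
theorem isWeightedHomogeneous_dwork (n k : ℕ) (d : Fin k → ℕ)
    (G : Fin k → MvPolynomial (Fin (n + 1)) ℂ) (hG : ∀ i, (G i).IsHomogeneous (d i)) :
    (dwork n k G).IsWeightedHomogeneous (chq n k d) 0 := by
  rw [← mem_weightedHomogeneousSubmodule]
  refine Submodule.sum_mem _ fun i _ => ?_
  rw [mem_weightedHomogeneousSubmodule]
  have hx : (rename (xVar n k) (G i)).IsWeightedHomogeneous (chq n k d) (d i : ℤ) := by
    refine isWeightedHomogeneous_rename fun m hm => ?_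
    rw [← hG i hm, Finsupp.weight_eq_sum, Finsupp.weight_eq_sum]
    simp [chq_xVar]
  have hy := isWeightedHomogeneous_X ℂ (chq n k d) (yVar n k i)
  rw [chq_yVar] at hy
  simpa using hy.mul hx

theorem HasCharge.isWeightedHomogeneous {n k : ℕ} {d : Fin k → ℕ} {lam : ℤ} {f : SuperAlg n k}
    (hf : HasCharge n k d lam f) (s : Finset (Fin (n + k + 1))) :
    (f s).IsWeightedHomogeneous (chq n k d) (lam + ∑ μ ∈ s, chq n k d μ) := by
  intro m hm
  have h := hf s m (mem_support_iff.mpr hm)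
  rw [chOf] at h
  rw [Finsupp.weight_eq_sum, ← h]
  simp

/-- Left multiplication by `η_μ`. -/
noncomputable def etaMul (n k : ℕ) (μ : Fin (n + k + 1)) (f : SuperAlg n k) : SuperAlg n k :=
  fun s =>
    if μ ∈ s then (-1 : CoordRing n k) ^ (s.filter fun j => j < μ).card * f (s.erase μ) else 0

theorem gmul_Rel (n k : ℕ) (d : Fin k → ℕ) (f : SuperAlg n k) (s : Finset (Fin (n + k + 1))) :
    gmul n k (Rel n k d) f s =
      ∑ μ, (chq n k d μ : CoordRing n k) * (X μ * etaMul n k μ f s) := by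
  simp only [gmul, Rel, Finset.sum_mul, Finset.smul_sum]
  rw [Finset.sum_comm]
  refine Finset.sum_congr rfl fun μ _ => ?_
  by_cases hμ : μ ∈ s
  · rw [Finset.sum_eq_single_of_mem {μ} (by simpa using hμ)
      (fun t _ ht => by simp [ht])]
    rw [Finset.sdiff_singleton_eq_erase]
    have hs : (({μ} : Finset (Fin (n + k + 1))) ×ˢ s.erase μ).filter (fun p => p.2 < p.1) =
        (s.filter fun j => j < μ).map ⟨fun j => (μ, j), fun a b h => by simpa using h⟩ := by
      ext ⟨a, b⟩
      simp only [Finset.mem_filter, Finset.mem_product, Finset.mem_singleton, Finset.mem_erase,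
        Finset.mem_map]
      constructor
      · rintro ⟨⟨rfl, -, hb⟩, hlt⟩
        exact ⟨b, ⟨hb, hlt⟩, rfl⟩
      · rintro ⟨b, ⟨hb, hlt⟩, h⟩
        obtain ⟨rfl, rfl⟩ := h
        exact ⟨⟨rfl, hlt.ne, hb⟩, hlt⟩
    simp only [ksign, hs, Finset.card_map, etaMul, if_pos hμ, if_true, zsmul_eq_mul]
    push_cast
    ring
  · rw [Finset.sum_eq_zero]
    · simp [etaMul, hμ]
    · intro t ht
      have : t ≠ {μ} := by
        rintro rfl
        exact hμ (by simpa using ht)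
      simp [this]

theorem etaMul_etaDeriv_self (n k : ℕ) (i : Fin (n + k + 1)) (f : SuperAlg n k)
    (s : Finset (Fin (n + k + 1))) :
    etaMul n k i (etaDeriv n k i f) s = if i ∈ s then f s else 0 := by
  by_cases hi : i ∈ s
  · have : (s.erase i).filter (fun j => j < i) = s.filter fun j => j < i := by
      ext j
      simp only [Finset.mem_filter, Finset.mem_erase]
      exact ⟨fun h => ⟨h.1.2, h.2⟩, fun h => ⟨⟨h.2.ne, h.1⟩, h.2⟩⟩
    simp [etaMul, etaDeriv, hi, this, Finset.insert_erase hi, ← mul_assoc, ← mul_pow]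
  · simp [etaMul, hi]

theorem etaDeriv_etaMul_self (n k : ℕ) (i : Fin (n + k + 1)) (f : SuperAlg n k)
    (s : Finset (Fin (n + k + 1))) :
    etaDeriv n k i (etaMul n k i f) s = if i ∈ s then 0 else f s := by
  by_cases hi : i ∈ s
  · simp [etaDeriv, hi]
  · simp [etaMul, etaDeriv, hi, Finset.filter_insert, Finset.erase_insert hi, ← mul_assoc,
      ← mul_pow]

theorem etaDeriv_etaMul_of_ne (n k : ℕ) {i μ : Fin (n + k + 1)} (h : i ≠ μ) (f : SuperAlg n k)
    (s : Finset (Fin (n + k + 1))) :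
    etaDeriv n k i (etaMul n k μ f) s = -etaMul n k μ (etaDeriv n k i f) s := by
  by_cases hi : i ∈ s
  · simp [etaDeriv, etaMul, hi, h]
  by_cases hμ : μ ∈ s
  · obtain ⟨u, hu, rfl⟩ : ∃ u, μ ∉ u ∧ insert μ u = s :=
      ⟨s.erase μ, by simp, Finset.insert_erase hμ⟩
    have hiu : i ∉ u := fun h' => hi (Finset.mem_insert_of_mem h')
    have he : (insert i (insert μ u)).erase μ = insert i u := by
      rw [Finset.insert_comm, Finset.erase_insert]
      simp [hu, h.symm]
    simp only [etaDeriv, etaMul, hi, hiu, he, if_false, if_true, Finset.mem_insert,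
      Finset.erase_insert hu, Finset.filter_insert, lt_irrefl, true_or, or_true]
    rcases lt_or_gt_of_ne h with hlt | hlt
    · rw [if_neg hlt.asymm, if_pos hlt, Finset.card_insert_of_notMem (by simp [hiu])]
      ring
    · rw [if_pos hlt, if_neg hlt.asymm, Finset.card_insert_of_notMem (by simp [hu])]
      ring
  · simp [etaDeriv, etaMul, hi, hμ, h.symm]

/-- The anticommutation relation `[∂/∂η_i, η_μ] = δ_{iμ}`. -/
theorem etaDeriv_etaMul (n k : ℕ) (i μ : Fin (n + k + 1)) (f : SuperAlg n k)
    (s : Finset (Fin (n + k + 1))) :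
    etaDeriv n k i (etaMul n k μ f) s =
      (if i = μ then f s else 0) - etaMul n k μ (etaDeriv n k i f) s := by
  by_cases h : i = μ
  · subst h
    rw [etaDeriv_etaMul_self, etaMul_etaDeriv_self]
    by_cases hi : i ∈ s <;> simp [hi]
  · rw [etaDeriv_etaMul_of_ne n k h, if_neg h, zero_sub]

theorem pderiv_neg_one_pow_mul {σ R : Type*} [CommRing R] (i : σ) (a : ℕ)
    (p : MvPolynomial σ R) : pderiv i ((-1) ^ a * p) = (-1) ^ a * pderiv i p := by
  rcases neg_one_pow_eq_or (MvPolynomial σ R) a with h | h <;> simp [h]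

theorem pderiv_intCast_mul {σ R : Type*} [CommRing R] (i : σ) (a : ℤ)
    (p : MvPolynomial σ R) : pderiv i ((a : MvPolynomial σ R) * p) = a * pderiv i p := by
  rw [← zsmul_eq_mul, map_zsmul, zsmul_eq_mul]

theorem sum_etaMul_etaDeriv (n k : ℕ) (P : CoordRing n k) (μ : Fin (n + k + 1))
    (f : SuperAlg n k) (s : Finset (Fin (n + k + 1))) :
    ∑ i, (pderiv i P * etaMul n k μ (etaDeriv n k i f) s +
      pderiv i (etaMul n k μ (etaDeriv n k i f) s)) = etaMul n k μ (Kop n k P f) s := by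
  by_cases hμ : μ ∈ s
  · simp only [etaMul, if_pos hμ, pderiv_neg_one_pow_mul, Kop, Qop, Dop,
      ← Finset.sum_add_distrib, Finset.mul_sum]
    exact Finset.sum_congr rfl fun i _ => by ring
  · simp [etaMul, hμ]

theorem etaDeriv_gmul_Rel (n k : ℕ) (d : Fin k → ℕ) (i : Fin (n + k + 1)) (f : SuperAlg n k)
    (s : Finset (Fin (n + k + 1))) :
    etaDeriv n k i (gmul n k (Rel n k d) f) s =
      (chq n k d i : CoordRing n k) * (X i * f s) -
        ∑ μ, (chq n k d μ : CoordRing n k) * (X μ * etaMul n k μ (etaDeriv n k i f) s) := by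
  have h : etaDeriv n k i (gmul n k (Rel n k d) f) s =
      ∑ μ, (chq n k d μ : CoordRing n k) * (X μ * etaDeriv n k i (etaMul n k μ f) s) := by
    by_cases hi : i ∈ s
    · simp [etaDeriv, hi]
    · simp only [etaDeriv, if_neg hi, gmul_Rel, Finset.mul_sum]
      exact Finset.sum_congr rfl fun μ _ => by ring
  rw [h]
  simp only [etaDeriv_etaMul, mul_sub, Finset.sum_sub_distrib]
  simp

theorem Kop_smul (n k : ℕ) (P : CoordRing n k) (c : ℂ) (f : SuperAlg n k) :
    Kop n k P (c • f) = c • Kop n k P f := by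
  have h : ∀ i s, etaDeriv n k i (c • f) s = c • etaDeriv n k i f s := by
    intro i s
    simp only [etaDeriv, Pi.smul_apply]
    split_ifs <;> simp
  funext s
  simp only [Kop, Qop, Dop, h, Pi.smul_apply, smul_add, Finset.smul_sum, mul_smul_comm,
    Derivation.map_smul]

/-- The homotopy formula `K(R·f) + R·K(f) = (λ − c_G)·f` for `f` of charge `λ`. -/
theorem Kop_gmul_Rel (n k : ℕ) (d : Fin k → ℕ) {P : CoordRing n k}
    (hP : P.IsWeightedHomogeneous (chq n k d) 0) {lam : ℤ} {f : SuperAlg n k}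
    (hf : HasCharge n k d lam f) (s : Finset (Fin (n + k + 1))) :
    Kop n k P (gmul n k (Rel n k d) f) s + gmul n k (Rel n k d) (Kop n k P f) s =
      ((lam - cG n k d : ℤ) : CoordRing n k) * f s := by
  have hsum : ∀ i, pderiv i P * etaDeriv n k i (gmul n k (Rel n k d) f) s +
      pderiv i (etaDeriv n k i (gmul n k (Rel n k d) f) s) =
      ((chq n k d i : CoordRing n k) * (X i * pderiv i P)) * f s +
        (chq n k d i : CoordRing n k) * f s +
        (chq n k d i : CoordRing n k) * (X i * pderiv i (f s)) -
        (if i ∈ s then (chq n k d i : CoordRing n k) * f s else 0) -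
        ∑ μ, (chq n k d μ : CoordRing n k) * (X μ *
          (pderiv i P * etaMul n k μ (etaDeriv n k i f) s +
            pderiv i (etaMul n k μ (etaDeriv n k i f) s))) := by
    intro i
    have h : ∑ μ, (chq n k d μ : CoordRing n k) *
        pderiv i (X μ * etaMul n k μ (etaDeriv n k i f) s) =
        (if i ∈ s then (chq n k d i : CoordRing n k) * f s else 0) +
        ∑ μ, (chq n k d μ : CoordRing n k) * (X μ *
            pderiv i (etaMul n k μ (etaDeriv n k i f) s)) := by
      simp only [Derivation.leibniz, smul_eq_mul, pderiv_X, mul_add, Finset.sum_add_distrib]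
      rw [add_comm]
      congr 1
      rw [Finset.sum_eq_single i]
      · simp [etaMul_etaDeriv_self]
      · intro μ _ hμ
        simp [hμ]
      · simp
    rw [etaDeriv_gmul_Rel, map_sub, map_sum]
    simp only [pderiv_intCast_mul, h]
    simp only [Derivation.leibniz, smul_eq_mul, pderiv_X_self, mul_add, Finset.sum_add_distrib,
      mul_sub, Finset.mul_sum]
    simp only [mul_left_comm (pderiv i P)]
    ring
  have hK : Kop n k P (gmul n k (Rel n k d) f) s =
      ∑ i, (pderiv i P * etaDeriv n k i (gmul n k (Rel n k d) f) s +
        pderiv i (etaDeriv n k i (gmul n k (Rel n k d) f) s)) := by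
    rw [Finset.sum_add_distrib]
    rfl
  have hR : ∑ i, ∑ μ, (chq n k d μ : CoordRing n k) * (X μ *
      (pderiv i P * etaMul n k μ (etaDeriv n k i f) s +
        pderiv i (etaMul n k μ (etaDeriv n k i f) s))) =
      gmul n k (Rel n k d) (Kop n k P f) s := by
    rw [Finset.sum_comm, gmul_Rel]
    simp only [← Finset.mul_sum, sum_etaMul_etaDeriv]
  have hch : ∑ i, (chq n k d i : CoordRing n k) = -((cG n k d : ℤ) : CoordRing n k) := by
    exact_mod_cast congrArg (Int.cast : ℤ → CoordRing n k) (sum_chq n k d)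
  rw [hK, Finset.sum_congr rfl fun i _ => hsum i]
  simp only [Finset.sum_sub_distrib, Finset.sum_add_distrib, hR, ← Finset.sum_mul,
    sum_intWeight_mul_X_mul_pderiv hP,
    sum_intWeight_mul_X_mul_pderiv (hf.isWeightedHomogeneous s), hch]
  rw [Finset.sum_ite_mem, Finset.univ_inter, ← Finset.sum_mul]
  push_cast
  ring

/-- the cohomology of `(𝒜, K)` is concentrated in charge `c_G`:
if `λ ≠ c_G` and `f ∈ 𝒜_λ` with `K(f) = 0`, then `f = K((λ − c_G)⁻¹·R·f)`. -/
theorem stmt10 (n k : ℕ) (hk : 1 ≤ k) (hkn : k ≤ n)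
    (d : Fin k → ℕ) (hd : ∀ i, 1 ≤ d i)
    (G : Fin k → MvPolynomial (Fin (n + 1)) ℂ)
    (hG : ∀ i, (G i).IsHomogeneous (d i)) :
    ∀ (lam : ℤ) (f : SuperAlg n k), HasCharge n k d lam f → lam ≠ cG n k d →
      Kop n k (dwork n k G) f = 0 →
      f = Kop n k (dwork n k G)
            ((((lam - cG n k d : ℤ) : ℂ))⁻¹ • gmul n k (Rel n k d) f) := by
  intro lam f hf hlam hK
  have hne : ((lam - cG n k d : ℤ) : ℂ) ≠ 0 := Int.cast_ne_zero.mpr (sub_ne_zero.mpr hlam)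
  have h : Kop n k (dwork n k G) (gmul n k (Rel n k d) f) =
      ((lam - cG n k d : ℤ) : ℂ) • f := by
    funext s
    have h := Kop_gmul_Rel n k d (isWeightedHomogeneous_dwork n k d G hG) hf s
    rw [hK, gmul_Rel] at h
    simpa [etaMul, Algebra.smul_def] using h
  rw [Kop_smul, h, inv_smul_smul₀ hne]

end PeriodCI
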